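/- Let F : M_F(K) → ℝ be continuous (K = [a,b]^d compact) and define P_n(F)(μ) := F(χ_n(μ)) with χ_n the Bernstein discretization. Then for every C > 0, P_n(F) → F uniformly on N_C(K) = {μ : μ(K) ≤ C} as n → ∞. -/

import Mathlib

open MeasureTheory Filter Topology
open scoped NNReal ENNReal

noncomputable section

/-- The Dirac measure at `x`, as a finite measure. -/
def diracFM {Y : Type*} [MeasurableSpace Y] (x : Y) : FiniteMeasure Y :=
  ⟨Measure.dirac x, inferInstance⟩

/-- The grid point `a^n_{j}` in `[a,b]^d`. -/
def bnode (a b : ℝ) (d n : ℕ) (j : Fin d → Fin (n + 1)) : Fin d → ℝ :=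
  fun k => a + ((j k : ℕ) : ℝ) * (b - a) / n

/-- The multivariate Bernstein basis polynomial `φ^n_j`. -/
def bpoly (a b : ℝ) (d n : ℕ) (j : Fin d → Fin (n + 1)) (x : Fin d → ℝ) : ℝ :=
  (b - a)⁻¹ ^ (n * d) *
    ∏ k : Fin d, (n.choose (j k) : ℝ) * (x k - a) ^ (j k : ℕ) * (b - x k) ^ (n - (j k : ℕ))

/-- The Bernstein discretization `χ_n(μ) = Σ_j ⟨φ^n_j, μ⟩ δ_{a^n_j}` of a finite measure. -/
def chiB (a b : ℝ) (d n : ℕ) (μ : FiniteMeasure (Fin d → ℝ)) : FiniteMeasure (Fin d → ℝ) :=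
  ∑ j : Fin d → Fin (n + 1),
    (∫ x, bpoly a b d n j x ∂(μ : Measure (Fin d → ℝ))).toNNReal • diracFM (bnode a b d n j)


/-- Normalised coordinate of a point of the cube. -/
def tco (a b : ℝ) (hab : a < b) {d : ℕ} (x : Fin d → ℝ)
    (hx : x ∈ Set.Icc (fun _ : Fin d => a) (fun _ => b)) (k : Fin d) : unitInterval :=
  ⟨(x k - a) / (b - a), by
    have h1 := hx.1 k
    have h2 := hx.2 k
    have h3 : 0 < b - a := sub_pos.2 hab
    simp only at h1 h2
    exact ⟨div_nonneg (by linarith) h3.le, (div_le_one h3).2 (by linarith)⟩⟩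

lemma bpoly_eq (a b : ℝ) (hab : a < b) {d : ℕ} (n : ℕ) (j : Fin d → Fin (n + 1)) (x : Fin d → ℝ)
    (hx : x ∈ Set.Icc (fun _ : Fin d => a) (fun _ => b)) :
    bpoly a b d n j x = ∏ k, bernstein n (j k) (tco a b hab x hx k) := by
  have h3 : b - a ≠ 0 := (sub_pos.2 hab).ne'
  have : (b - a)⁻¹ ^ (n * d) = ∏ _k : Fin d, (b - a)⁻¹ ^ n := by
    simp [pow_mul]
  rw [bpoly, this, ← Finset.prod_mul_distrib]
  refine Finset.prod_congr rfl fun k _ => ?_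
  rw [bernstein_apply]
  have e : 1 - ((tco a b hab x hx k : unitInterval) : ℝ) = (b - x k) / (b - a) := by
    simp only [tco]
    field_simp
    ring
  rw [e]
  simp only [tco]
  have hn : (b - a)⁻¹ ^ n = (b - a)⁻¹ ^ (j k : ℕ) * (b - a)⁻¹ ^ (n - (j k : ℕ)) := by
    rw [← pow_add]
    congr 1
    have := (j k).is_le
    omega
  rw [hn, div_eq_mul_inv, div_eq_mul_inv, mul_pow, mul_pow]
  ring

lemma bpoly_nonneg (a b : ℝ) (hab : a < b) {d : ℕ} (n : ℕ) (j : Fin d → Fin (n + 1))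
    (x : Fin d → ℝ) (hx : x ∈ Set.Icc (fun _ : Fin d => a) (fun _ => b)) :
    0 ≤ bpoly a b d n j x := by
  rw [bpoly_eq a b hab n j x hx]
  exact Finset.prod_nonneg fun k _ => bernstein_nonneg

lemma sum_marginal {d m : ℕ} (p : Fin d → Fin m → ℝ) (hp : ∀ k, ∑ i, p k i = 1)
    (k0 : Fin d) (g : Fin m → ℝ) :
    ∑ j : Fin d → Fin m, g (j k0) * ∏ k, p k (j k) = ∑ i, g i * p k0 i := by
  have h := Fintype.prod_sum (fun (k : Fin d) (i : Fin m) => (if k = k0 then g i else 1) * p k i)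
  simp only [Finset.prod_mul_distrib] at h
  simp only [Finset.prod_ite_eq', Finset.mem_univ, if_true] at h
  rw [← h, Finset.prod_eq_single k0]
  · simp
  · intro k _ hk
    simp [hk, hp]
  · simp

lemma bpoly_sum (a b : ℝ) (hab : a < b) {d : ℕ} (n : ℕ)
    (x : Fin d → ℝ) (hx : x ∈ Set.Icc (fun _ : Fin d => a) (fun _ => b)) :
    ∑ j, bpoly a b d n j x = 1 := by
  simp only [bpoly_eq a b hab n _ x hx]
  rw [← Fintype.prod_sum (fun (k : Fin d) (i : Fin (n + 1)) =>
    bernstein n i (tco a b hab x hx k))]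
  simp

lemma bpoly_var (a b : ℝ) (hab : a < b) {d : ℕ} (n : ℕ) (hn : n ≠ 0)
    (x : Fin d → ℝ) (hx : x ∈ Set.Icc (fun _ : Fin d => a) (fun _ => b)) (k0 : Fin d) :
    ∑ j, (x k0 - bnode a b d n j k0) ^ 2 * bpoly a b d n j x ≤ (b - a) ^ 2 / n := by
  have h3 : 0 < b - a := sub_pos.2 hab
  have hn' : (0 : ℝ) < n := by positivity
  simp only [bpoly_eq a b hab n _ x hx]
  have h := sum_marginal (fun (k : Fin d) (i : Fin (n + 1)) =>
    bernstein n i (tco a b hab x hx k)) (by simp) k0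
    (fun i => (x k0 - (a + ((i : ℕ) : ℝ) * (b - a) / n)) ^ 2)
  simp only [bnode]
  rw [h]
  have hv := bernstein.variance hn (tco a b hab x hx k0)
  have : ∑ i : Fin (n + 1), (x k0 - (a + ((i : ℕ) : ℝ) * (b - a) / n)) ^ 2 *
      bernstein n i (tco a b hab x hx k0) =
      (b - a) ^ 2 * ∑ i : Fin (n + 1), (tco a b hab x hx k0 - bernstein.z i : ℝ) ^ 2 *
        bernstein n i (tco a b hab x hx k0) := by
    rw [Finset.mul_sum]
    refine Finset.sum_congr rfl fun i _ => ?_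
    rw [← mul_assoc, ← mul_pow]
    congr 2
    simp only [tco, bernstein.z]
    field_simp
    ring
  rw [this, hv, mul_div_assoc']
  gcongr
  have t0 := (tco a b hab x hx k0).2.1
  have t1 := (tco a b hab x hx k0).2.2
  have : ((tco a b hab x hx k0 : unitInterval) : ℝ) * (1 - tco a b hab x hx k0) ≤ 1 := by
    nlinarith
  nlinarith [sq_nonneg (b - a)]

lemma bnode_mem (a b : ℝ) (hab : a < b) {d : ℕ} (n : ℕ) (j : Fin d → Fin (n + 1)) :
    bnode a b d n j ∈ Set.Icc (fun _ : Fin d => a) (fun _ => b) := by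
  have h3 : 0 < b - a := sub_pos.2 hab
  have key : ∀ k, bnode a b d n j k = a + (bernstein.z (j k) : ℝ) * (b - a) := by
    intro k
    simp only [bnode, bernstein.z]
    ring
  refine ⟨fun k => ?_, fun k => ?_⟩
  · rw [key]
    have := (bernstein.z (j k)).2.1
    nlinarith
  · rw [key]
    have := (bernstein.z (j k)).2.2
    nlinarith

open BoundedContinuousFunction in
lemma bern_unif (a b : ℝ) (hab : a < b) (d : ℕ) (f : (Fin d → ℝ) →ᵇ ℝ) (ε : ℝ) (hε : 0 < ε) :
    ∀ᶠ n : ℕ in atTop, ∀ x ∈ Set.Icc (fun _ : Fin d => a) (fun _ => b),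
      |∑ j, bpoly a b d n j x * f (bnode a b d n j) - f x| ≤ ε := by
  have hK : IsCompact (Set.Icc (fun _ : Fin d => a) (fun _ => b)) := isCompact_Icc
  have hu := hK.uniformContinuousOn_of_continuous f.continuous.continuousOn
  rw [Metric.uniformContinuousOn_iff] at hu
  obtain ⟨δ, hδ, hu⟩ := hu (ε / 2) (by positivity)
  set M : ℝ := 2 * ‖f‖ / δ ^ 2 with hM
  have hM0 : 0 ≤ M := by positivity
  have hpt : ∀ x ∈ Set.Icc (fun _ : Fin d => a) (fun _ => b),
      ∀ y ∈ Set.Icc (fun _ : Fin d => a) (fun _ => b),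
      |f y - f x| ≤ ε / 2 + M * ∑ k, (x k - y k) ^ 2 := by
    intro x hx y hy
    have hs : 0 ≤ ∑ k, (x k - y k) ^ 2 := Finset.sum_nonneg fun k _ => sq_nonneg _
    by_cases h : dist y x < δ
    · have := hu y hy x hx h
      rw [Real.dist_eq] at this
      nlinarith [mul_nonneg hM0 hs]
    · have h' : ∃ k, δ ≤ dist (y k) (x k) := by
        by_contra hc
        push Not at hc
        exact h ((dist_pi_lt_iff hδ).2 hc)
      obtain ⟨k, hk⟩ := h'
      have h1 : δ ^ 2 ≤ ∑ k, (x k - y k) ^ 2 := by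
        calc δ ^ 2 ≤ dist (y k) (x k) ^ 2 := by gcongr
          _ = (x k - y k) ^ 2 := by rw [Real.dist_eq, sq_abs]; ring
          _ ≤ _ := Finset.single_le_sum (f := fun k => (x k - y k) ^ 2)
            (fun k _ => sq_nonneg _) (Finset.mem_univ k)
      have h2 : |f y - f x| ≤ 2 * ‖f‖ := by
        rw [← Real.dist_eq]; exact f.dist_le_two_norm y x
      have h4 : 2 * ‖f‖ = M * δ ^ 2 := by
        rw [hM]; field_simp
      nlinarith [mul_le_mul_of_nonneg_left h1 hM0]
  have hlim : Tendsto (fun n : ℕ => M * (d * (b - a) ^ 2) / n) atTop (𝓝 0) :=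
    tendsto_const_div_atTop_nhds_zero_nat _
  filter_upwards [hlim.eventually (gt_mem_nhds (half_pos hε)), eventually_ne_atTop 0]
    with n hn hn0 x hx
  have hφ := fun j => bpoly_nonneg a b hab n j x hx
  calc |∑ j, bpoly a b d n j x * f (bnode a b d n j) - f x|
      = |∑ j, bpoly a b d n j x * (f (bnode a b d n j) - f x)| := by
        simp only [mul_sub, Finset.sum_sub_distrib, ← Finset.sum_mul, bpoly_sum a b hab n x hx,
          one_mul]
    _ ≤ ∑ j, |bpoly a b d n j x * (f (bnode a b d n j) - f x)| := Finset.abs_sum_le_sum_abs _ _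
    _ ≤ ∑ j, bpoly a b d n j x * (ε / 2 + M * ∑ k, (x k - bnode a b d n j k) ^ 2) := by
        refine Finset.sum_le_sum fun j _ => ?_
        rw [abs_mul, abs_of_nonneg (hφ j)]
        exact mul_le_mul_of_nonneg_left (hpt x hx _ (bnode_mem a b hab n j)) (hφ j)
    _ = ε / 2 + M * ∑ k, ∑ j, (x k - bnode a b d n j k) ^ 2 * bpoly a b d n j x := by
        simp only [mul_add, Finset.sum_add_distrib, ← Finset.sum_mul, bpoly_sum a b hab n x hx,
          one_mul]
        rw [Finset.sum_comm, Finset.mul_sum]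
        congr 1
        refine Finset.sum_congr rfl fun j _ => ?_
        rw [← Finset.sum_mul]
        ring
    _ ≤ ε / 2 + M * ∑ k : Fin d, (b - a) ^ 2 / n := by
        gcongr with k
        exact bpoly_var a b hab n hn0 x hx k
    _ = ε / 2 + M * (d * (b - a) ^ 2) / n := by
        simp; ring
    _ ≤ ε := by linarith

lemma bpoly_cont (a b : ℝ) (d n : ℕ) (j : Fin d → Fin (n + 1)) : Continuous (bpoly a b d n j) := by
  unfold bpoly
  fun_prop

lemma ae_mem_K {a b : ℝ} {d : ℕ} {μ : FiniteMeasure (Fin d → ℝ)}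
    (hμ : (μ : Measure (Fin d → ℝ)) (Set.Icc (fun _ => a) (fun _ => b))ᶜ = 0) :
    ∀ᵐ x ∂(μ : Measure (Fin d → ℝ)), x ∈ Set.Icc (fun _ : Fin d => a) (fun _ => b) := by
  rw [ae_iff]
  exact hμ

lemma integrable_K {a b : ℝ} {d : ℕ} {μ : FiniteMeasure (Fin d → ℝ)}
    (hμ : (μ : Measure (Fin d → ℝ)) (Set.Icc (fun _ => a) (fun _ => b))ᶜ = 0)
    (g : (Fin d → ℝ) → ℝ) (hg : Continuous g) : Integrable g (μ : Measure (Fin d → ℝ)) := by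
  have h : IntegrableOn g (Set.Icc (fun _ : Fin d => a) (fun _ => b)) (μ : Measure (Fin d → ℝ)) :=
    hg.continuousOn.integrableOn_compact isCompact_Icc
  rwa [IntegrableOn, Measure.restrict_eq_self_of_ae_mem (ae_mem_K hμ)] at h

lemma chiB_supp (a b : ℝ) (hab : a < b) (d n : ℕ) (μ : FiniteMeasure (Fin d → ℝ)) :
    (chiB a b d n μ : Measure (Fin d → ℝ)) (Set.Icc (fun _ => a) (fun _ => b))ᶜ = 0 := by
  have hm : MeasurableSet (Set.Icc (fun _ : Fin d => a) (fun _ => b))ᶜ := measurableSet_Icc.compl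
  rw [chiB, FiniteMeasure.toMeasure_sum, Measure.finsetSum_apply]
  refine Finset.sum_eq_zero fun j _ => ?_
  rw [FiniteMeasure.toMeasure_smul, Measure.smul_apply]
  have : (diracFM (bnode a b d n j) : Measure (Fin d → ℝ))
      (Set.Icc (fun _ => a) (fun _ => b))ᶜ = 0 := by
    change Measure.dirac _ _ = 0
    rw [Measure.dirac_apply' _ hm]
    simp only [Set.indicator_apply_eq_zero]
    intro h
    exact absurd (bnode_mem a b hab n j) h
  rw [this, smul_zero]

open BoundedContinuousFunction in
lemma chiB_integral (a b : ℝ) (hab : a < b) (d n : ℕ) (μ : FiniteMeasure (Fin d → ℝ))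
    (hμ : (μ : Measure (Fin d → ℝ)) (Set.Icc (fun _ => a) (fun _ => b))ᶜ = 0)
    (f : (Fin d → ℝ) →ᵇ ℝ) :
    ∫ x, f x ∂(chiB a b d n μ : Measure (Fin d → ℝ)) =
      ∫ x, ∑ j, bpoly a b d n j x * f (bnode a b d n j) ∂(μ : Measure (Fin d → ℝ)) := by
  rw [integral_finsetSum _ fun j _ => (integrable_K hμ _ (bpoly_cont a b d n j)).mul_const _]
  rw [chiB, FiniteMeasure.toMeasure_sum, integral_finsetSum_measure fun j _ => f.integrable _]
  refine Finset.sum_congr rfl fun j _ => ?_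
  rw [FiniteMeasure.toMeasure_smul, integral_mul_const, integral_smul_nnreal_measure]
  have : ∫ x, f x ∂(diracFM (bnode a b d n j) : Measure (Fin d → ℝ)) = f (bnode a b d n j) := by
    change ∫ x, f x ∂(Measure.dirac _) = _
    exact integral_dirac _ _
  rw [this, NNReal.smul_def, smul_eq_mul, Real.coe_toNNReal]
  refine integral_nonneg_of_ae ?_
  filter_upwards [ae_mem_K hμ] with x hx using bpoly_nonneg a b hab n j x hx

lemma chiB_tendsto (a b : ℝ) (hab : a < b) (d : ℕ) (C : ℝ≥0) (μ₀ : FiniteMeasure (Fin d → ℝ)) :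
    Tendsto (fun p : ℕ × FiniteMeasure (Fin d → ℝ) => chiB a b d p.1 p.2)
      (atTop ×ˢ 𝓝[{μ : FiniteMeasure (Fin d → ℝ) |
        (μ : Measure (Fin d → ℝ)) (Set.Icc (fun _ => a) (fun _ => b))ᶜ = 0 ∧
          μ Set.univ ≤ C}] μ₀) (𝓝 μ₀) := by
  rw [FiniteMeasure.tendsto_iff_forall_integral_tendsto]
  intro f
  have h2 : Tendsto (fun p : ℕ × FiniteMeasure (Fin d → ℝ) =>
      ∫ x, f x ∂(p.2 : Measure (Fin d → ℝ)))
      (atTop ×ˢ 𝓝[{μ : FiniteMeasure (Fin d → ℝ) |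
        (μ : Measure (Fin d → ℝ)) (Set.Icc (fun _ => a) (fun _ => b))ᶜ = 0 ∧
          μ Set.univ ≤ C}] μ₀) (𝓝 (∫ x, f x ∂(μ₀ : Measure (Fin d → ℝ)))) :=
    FiniteMeasure.tendsto_iff_forall_integral_tendsto.1
      (tendsto_snd.mono_right nhdsWithin_le_nhds) f
  refine h2.congr_dist ?_
  rw [Metric.tendsto_nhds]
  intro ε hε
  have hη : 0 < ε / (C + 1) := by positivity
  have hS := eventually_mem_nhdsWithin (a := μ₀) (s := {μ : FiniteMeasure (Fin d → ℝ) |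
        (μ : Measure (Fin d → ℝ)) (Set.Icc (fun _ => a) (fun _ => b))ᶜ = 0 ∧
          μ Set.univ ≤ C})
  filter_upwards [(bern_unif a b hab d f _ hη).prod_mk hS] with p hp
  obtain ⟨hn, hμ, hm⟩ := hp
  obtain ⟨n, μ⟩ := p
  simp only at hn hμ hm ⊢
  rw [chiB_integral a b hab d n μ hμ f, Real.dist_0_eq_abs, abs_of_nonneg dist_nonneg, dist_comm,
    Real.dist_eq, ← integral_sub ?_ (f.integrable _)]
  · have h := norm_integral_le_of_norm_le_const (μ := (μ : Measure (Fin d → ℝ)))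
      (f := fun x => ∑ j, bpoly a b d n j x * f (bnode a b d n j) - f x) (C := ε / (C + 1))
      (by filter_upwards [ae_mem_K hμ] with x hx using hn x hx)
    rw [Real.norm_eq_abs] at h
    refine h.trans_lt ?_
    have hm' : (μ : Measure (Fin d → ℝ)).real Set.univ ≤ C := by exact_mod_cast hm
    calc _ ≤ ε / (C + 1) * C := by gcongr
      _ < ε / (C + 1) * (C + 1) := by gcongr; linarith
      _ = ε := by field_simp
  · exact integrable_K hμ _ (continuous_finsetSum _ fun j _ =>
      (bpoly_cont a b d n j).mul continuous_const)

/-- Let `F : M_F(K) → ℝ` be continuous (`K = [a,b]^d`) and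
`P_n(F)(μ) := F(χ_n(μ))`. Then for every `C > 0`, `P_n(F) → F` uniformly on
`N_C(K) = {μ supported in K : μ(K) ≤ C}` as `n → ∞`. -/
theorem statement8 (d : ℕ) (a b : ℝ) (hab : a < b)
    (F : FiniteMeasure (Fin d → ℝ) → ℝ)
    (hF : ContinuousOn F
      {μ : FiniteMeasure (Fin d → ℝ) |
        (μ : Measure (Fin d → ℝ)) (Set.Icc (fun _ => a) (fun _ => b))ᶜ = 0})
    (C : ℝ≥0) (hC : 0 < C) :
    TendstoUniformlyOn (fun n μ => F (chiB a b d n μ)) F Filter.atTop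
      {μ : FiniteMeasure (Fin d → ℝ) |
        (μ : Measure (Fin d → ℝ)) (Set.Icc (fun _ => a) (fun _ => b))ᶜ = 0 ∧
          μ Set.univ ≤ C} := by
  have hcomp : IsCompact {μ : FiniteMeasure (Fin d → ℝ) |
        (μ : Measure (Fin d → ℝ)) (Set.Icc (fun _ => a) (fun _ => b))ᶜ = 0 ∧
          μ Set.univ ≤ C} := by
    have h := isCompact_setOfPred_finiteMeasure_le_of_isCompact C
      (isCompact_Icc : IsCompact (Set.Icc (fun _ : Fin d => a) (fun _ => b)))
    convert h using 1
    ext μ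
    simp only [Set.mem_ofPred_eq, FiniteMeasure.null_iff_toMeasure_null, FiniteMeasure.mass]
    exact and_comm
  rw [← tendstoLocallyUniformlyOn_iff_tendstoUniformlyOn_of_compact hcomp,
    tendstoLocallyUniformlyOn_iff_forall_tendsto]
  intro μ₀ hμ₀
  have h1 := (hF μ₀ hμ₀.1).tendsto.comp (tendsto_nhdsWithin_iff.2
    ⟨chiB_tendsto a b hab d C μ₀, Eventually.of_forall fun p => chiB_supp a b hab d p.1 p.2⟩)
  have h2 : Tendsto (fun p : ℕ × FiniteMeasure (Fin d → ℝ) => F p.2)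
      (atTop ×ˢ 𝓝[{μ : FiniteMeasure (Fin d → ℝ) |
        (μ : Measure (Fin d → ℝ)) (Set.Icc (fun _ => a) (fun _ => b))ᶜ = 0 ∧
          μ Set.univ ≤ C}] μ₀) (𝓝 (F μ₀)) :=
    ((hF μ₀ hμ₀.1).tendsto.mono_left (nhdsWithin_mono _ fun μ hμ => hμ.1)).comp tendsto_snd
  exact (h2.prodMk_nhds h1).mono_right (nhds_le_uniformity (F μ₀))
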